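/- arXiv:2602.13914 — 2 statements merged into one kernel-verified Lean document; each statement's English description precedes it below -/
import Mathlib

section
/- Let t_a be the topology on ℤ generated by the sets {2n, 2n+1} (n ∈ ℤ) and t_b the topology on ℤ generated by the sets {2n+1, 2n+2} (n ∈ ℤ), and let W ⊆ ℤ be the set of even integers. Then W satisfies the Two condition with respect to both t_a and t_b: for ι ∈ {a, b} with Cantor derivative d_ι of t_ι and every x ∈ ℤ, if x ∈ W then x ∉ d_ι(W) and x ∈ d_ι(ℤ \ W), and if x ∉ W then x ∉ d_ι(ℤ \ W) and x ∈ d_ι(W). -/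
/-- The Cantor derivative operator of a topology `t` on `X`. -/
def cantorDeriv {X : Type*} (t : TopologicalSpace X) (A : Set X) : Set X :=
  {x | ∀ U : Set X, @IsOpen X t U → x ∈ U → (A ∩ (U \ {x})).Nonempty}

/-- Agent `a`'s topology on ℤ: generated by the pairs `{2n, 2n+1}`. -/
def ta : TopologicalSpace ℤ :=
  TopologicalSpace.generateFrom {S : Set ℤ | ∃ n : ℤ, S = {2 * n, 2 * n + 1}}

/-- Agent `b`'s topology on ℤ: generated by the pairs `{2n+1, 2n+2}`. -/
def tb : TopologicalSpace ℤ :=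
  TopologicalSpace.generateFrom {S : Set ℤ | ∃ n : ℤ, S = {2 * n + 1, 2 * n + 2}}

theorem mem_of_isOpen_generateFrom {X : Type*} {B : Set (Set X)} {x y : X}
    (h : ∀ S ∈ B, x ∈ S → y ∈ S) {U : Set X}
    (hU : @IsOpen X (TopologicalSpace.generateFrom B) U) (hx : x ∈ U) : y ∈ U := by
  change TopologicalSpace.GenerateOpen B U at hU
  induction hU with
  | basic S hS => exact h S hS hx
  | univ => trivial
  | inter S T _ _ ihS ihT => exact ⟨ihS hx.1, ihT hx.2⟩
  | sUnion C _ ih =>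
    obtain ⟨S, hS, hxS⟩ := hx
    exact ⟨S, hS, ih S hS hxS⟩

/-- If `{x, y}` is the smallest neighbourhood of `x`, membership of `x` in a derived set is decided
by `y`. -/
theorem mem_cantorDeriv_generateFrom_iff {X : Type*} {B : Set (Set X)} {x y : X} (hne : y ≠ x)
    (hB : {x, y} ∈ B) (h : ∀ S ∈ B, x ∈ S → y ∈ S) (A : Set X) :
    x ∈ cantorDeriv (TopologicalSpace.generateFrom B) A ↔ y ∈ A := by
  constructor
  · intro hx
    obtain ⟨z, hzA, hz, hzx⟩ :=
      hx {x, y} (TopologicalSpace.isOpen_generateFrom_of_mem hB) (Set.mem_insert x {y})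
    rcases hz with rfl | rfl
    · exact absurd rfl hzx
    · exact hzA
  · exact fun hy U hU hxU => ⟨y, hy, mem_of_isOpen_generateFrom h hU hxU, hne⟩

theorem exists_mem_cantorDeriv_ta_iff (x : ℤ) :
    ∃ y : ℤ, (Even y ↔ ¬Even x) ∧ ∀ A : Set ℤ, x ∈ cantorDeriv ta A ↔ y ∈ A := by
  rcases Int.even_or_odd' x with ⟨k, rfl | rfl⟩
  · refine ⟨2 * k + 1, by grind, mem_cantorDeriv_generateFrom_iff (by lia) ⟨k, rfl⟩ ?_⟩
    rintro S ⟨n, rfl⟩ hS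
    simp only [Set.mem_insert_iff, Set.mem_singleton_iff] at hS ⊢
    lia
  · refine ⟨2 * k, by grind,
      mem_cantorDeriv_generateFrom_iff (by lia) ⟨k, Set.pair_comm _ _⟩ ?_⟩
    rintro S ⟨n, rfl⟩ hS
    simp only [Set.mem_insert_iff, Set.mem_singleton_iff] at hS ⊢
    lia

theorem exists_mem_cantorDeriv_tb_iff (x : ℤ) :
    ∃ y : ℤ, (Even y ↔ ¬Even x) ∧ ∀ A : Set ℤ, x ∈ cantorDeriv tb A ↔ y ∈ A := by
  rcases Int.even_or_odd' x with ⟨k, rfl | rfl⟩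
  · refine ⟨2 * k - 1, by grind, mem_cantorDeriv_generateFrom_iff (by lia) ⟨k - 1, ?_⟩ ?_⟩
    · rw [Set.pair_comm]
      ring_nf
    rintro S ⟨n, rfl⟩ hS
    simp only [Set.mem_insert_iff, Set.mem_singleton_iff] at hS ⊢
    lia
  · refine ⟨2 * k + 2, by grind, mem_cantorDeriv_generateFrom_iff (by lia) ⟨k, rfl⟩ ?_⟩
    rintro S ⟨n, rfl⟩ hS
    simp only [Set.mem_insert_iff, Set.mem_singleton_iff] at hS ⊢
    lia

/-- The set of even integers satisfies the `Two` condition with respect to both `ta`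
and `tb`. -/
theorem evens_satisfy_two_condition :
    ∀ t ∈ ({ta, tb} : Set (TopologicalSpace ℤ)), ∀ x : ℤ,
      (x ∈ {m : ℤ | Even m} →
        x ∉ cantorDeriv t {m : ℤ | Even m} ∧ x ∈ cantorDeriv t {m : ℤ | Even m}ᶜ) ∧
      (x ∉ {m : ℤ | Even m} →
        x ∉ cantorDeriv t {m : ℤ | Even m}ᶜ ∧ x ∈ cantorDeriv t {m : ℤ | Even m}) := by
  rintro t ht x
  obtain ⟨y, hy, hA⟩ : ∃ y : ℤ, (Even y ↔ ¬Even x) ∧ ∀ A : Set ℤ, x ∈ cantorDeriv t A ↔ y ∈ A := by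
    rcases ht with rfl | rfl
    · exact exists_mem_cantorDeriv_ta_iff x
    · exact exists_mem_cantorDeriv_tb_iff x
  simp only [hA, Set.mem_compl_iff, Set.mem_ofPred_eq, hy]
  tauto
end

section
/- Let X be a finite set carrying two topologies t_a and t_b with Cantor derivatives d_a and d_b, and let W ⊆ X satisfy the Two condition with respect to both topologies. Let f_a, f_b : X → X be functions such that for ι ∈ {a, b} and every x ∈ X, f_ι(x) ≠ x and {x, f_ι(x)} is an atomic t_ι-open set, and set f = f_b ∘ f_a and g = f_a ∘ f_b. Then for every Q ⊆ X and every x ∈ X, if there exists k : ℕ with f^k(x) ∈ Q, then there exists k : ℕ with g^k(x) ∈ Q. (Thus the formula ⟨(a;b)*⟩q ∧ ¬⟨(b;a)*⟩q, together with common knowledge of Two, is unsatisfiable on finite bitopological derivative models.) -/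
/-- An atomic open set for a topology `t`: a nonempty `t`-open set with no nonempty
proper `t`-open subset. -/
def IsAtomicOpen {X : Type*} (t : TopologicalSpace X) (U : Set X) : Prop :=
  @IsOpen X t U ∧ U.Nonempty ∧
    ∀ V : Set X, @IsOpen X t V → V.Nonempty → V ⊆ U → V = U

/-- The `Two` condition for `W` with respect to the Cantor derivative of `t`. -/
def TwoCond {X : Type*} (t : TopologicalSpace X) (W : Set X) : Prop :=
  ∀ x : X,
    (x ∈ W → x ∉ cantorDeriv t W ∧ x ∈ cantorDeriv t Wᶜ) ∧
    (x ∉ W → x ∉ cantorDeriv t Wᶜ ∧ x ∈ cantorDeriv t W)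

/-- A fixed-point-free map whose pairs `{x, h x}` are all atomic open is an involution. -/
theorem involutive_of_isAtomicOpen_pair {X : Type*} (t : TopologicalSpace X) (h : X → X)
    (hh : ∀ x : X, h x ≠ x ∧ IsAtomicOpen t ({x, h x} : Set X)) :
    Function.Involutive h := by
  intro x
  obtain ⟨-, hox, -, hx⟩ := hh x
  obtain ⟨hne, hoy, -, hy⟩ := hh (h x)
  have hopen := hox.inter hoy
  have hnonempty : (({x, h x} : Set X) ∩ {h x, h (h x)}).Nonempty := ⟨h x, by simp, by simp⟩
  have heq : ({x, h x} : Set X) = {h x, h (h x)} :=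
    (hx _ hopen hnonempty Set.inter_subset_left).symm.trans
      (hy _ hopen hnonempty Set.inter_subset_right)
  have hmem : h (h x) ∈ ({x, h x} : Set X) := by simp [heq]
  exact hmem.resolve_right hne

/-- On a finite type, every forward iterate of a map with a left inverse `g` is also an
iterate of `g`. -/
theorem Function.LeftInverse.exists_iterate_eq {X : Type*} [Finite X] {f g : X → X}
    (hgf : Function.LeftInverse g f) (k : ℕ) (x : X) : ∃ m : ℕ, g^[m] x = f^[k] x := by
  obtain ⟨n, hn, hper⟩ := hgf.injective.mem_periodicPts x
  refine ⟨n * k - k, ?_⟩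
  have hfix : f^[n * k] x = x := hper.mul_const k
  rw [← Nat.sub_add_cancel (Nat.le_mul_of_pos_left k hn), Function.iterate_add_apply] at hfix
  calc g^[n * k - k] x = g^[n * k - k] (f^[n * k - k] (f^[k] x)) := by rw [hfix]
    _ = f^[k] x := hgf.iterate _ _

/-- On a finite bitopological derivative model validating `Two`, whenever `q` is
reachable in the future (iterating `f = f_b ∘ f_a`), it is also reachable in the past
(iterating `g = f_a ∘ f_b`): the formula `⟨(a;b)*⟩q ∧ ¬⟨(b;a)*⟩q` together with common
knowledge of `Two` is unsatisfiable on finite models. -/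
theorem finite_future_implies_past {X : Type*} [Finite X]
    (ta tb : TopologicalSpace X) (W : Set X)
    (hWa : TwoCond ta W) (hWb : TwoCond tb W)
    (fa fb : X → X)
    (hfa : ∀ x : X, fa x ≠ x ∧ IsAtomicOpen ta ({x, fa x} : Set X))
    (hfb : ∀ x : X, fb x ≠ x ∧ IsAtomicOpen tb ({x, fb x} : Set X))
    (f g : X → X) (hf : f = fb ∘ fa) (hg : g = fa ∘ fb) :
    ∀ (Q : Set X) (x : X), (∃ k : ℕ, f^[k] x ∈ Q) → ∃ k : ℕ, g^[k] x ∈ Q := by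
  rintro Q x ⟨k, hk⟩
  have hgf : Function.LeftInverse g f := by
    intro y
    simp [hf, hg, involutive_of_isAtomicOpen_pair ta fa hfa _,
      involutive_of_isAtomicOpen_pair tb fb hfb _]
  obtain ⟨m, hm⟩ := hgf.exists_iterate_eq k x
  exact ⟨m, hm ▸ hk⟩
end
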